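/- arXiv:2202.06564 — 3 statements merged into one kernel-verified Lean document; each statement's English description precedes it below -/
import Mathlib

section
/- Let N ≥ 1, let U be an N×N complex unitary matrix, and let c, s ∈ ℝ^N be vectors with nonnegative entries arranged in nonincreasing order (c₁ ≥ c₂ ≥ … ≥ c_N ≥ 0 and s₁ ≥ s₂ ≥ … ≥ s_N ≥ 0). Then the determinant det(I_N + diag(c) Uᴴ diag(s) U) is a real number and satisfies det(I_N + diag(c) Uᴴ diag(s) U) ≤ ∏_{i=1}^N (1 + c_i s_i), where the right-hand side equals det(I_N + Uᴴ diag(c) diag(s) U). -/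
open Matrix Finset

section

open scoped ComplexOrder

variable {n : Type*} [DecidableEq n]

theorem reflection_isHermitian (u : n → ℂ) (κ : ℝ) :
    (1 - (κ : ℂ) • vecMulVec u (star u))ᴴ = 1 - (κ : ℂ) • vecMulVec u (star u) := by
  simp [conjTranspose_sub, conjTranspose_smul, conjTranspose_vecMulVec]

theorem diagonal_eq_diagonal_update_add (a : n → ℝ) (p q : n) :
    diagonal (fun i => (a i : ℂ)) =
      diagonal (fun i => (Function.update a q (a p) i : ℂ)) + ((a q - a p : ℝ) : ℂ) •
        vecMulVec (Pi.single q 1) (star (Pi.single q 1)) := by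
  ext i j
  by_cases hi : i = q <;> by_cases hj : j = q <;>
    simp [diagonal_apply, vecMulVec_apply, Function.update_apply, hi, hj, Ne.symm]

theorem posDef_diagonal_add {a : n → ℝ} (ha : ∀ i, 0 < a i) {B : Matrix n n ℂ}
    (hB : B.PosSemidef) : (diagonal (fun i => (a i : ℂ)) + B).PosDef := by
  refine PosDef.add_posSemidef ?_ hB
  rw [posDef_diagonal_iff]
  intro i
  exact_mod_cast ha i

variable [Fintype n]

theorem reflection_mul_self {u : n → ℂ} {κ : ℝ} (h : (κ : ℂ) * (star u ⬝ᵥ u) = 2) :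
    (1 - (κ : ℂ) • vecMulVec u (star u)) * (1 - (κ : ℂ) • vecMulVec u (star u)) = 1 := by
  have : vecMulVec u (star u) * vecMulVec u (star u) =
      (star u ⬝ᵥ u) • vecMulVec u (star u) := by
    rw [vecMulVec_mul_vecMulVec, vecMulVec_smul]
  simp only [sub_mul, mul_sub, mul_one, one_mul, smul_mul_assoc, mul_smul_comm, this, smul_smul, h]
  module

theorem reflection_conj {u : n → ℂ} {κ : ℝ} (h : (κ : ℂ) * (star u ⬝ᵥ u) = 2)
    {D : Matrix n n ℂ} {a : ℂ} (hD : D *ᵥ u = a • u) (hD' : star u ᵥ* D = a • star u) :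
    (1 - (κ : ℂ) • vecMulVec u (star u)) * D * (1 - (κ : ℂ) • vecMulVec u (star u)) = D := by
  have : (1 - (κ : ℂ) • vecMulVec u (star u)) * D = D * (1 - (κ : ℂ) • vecMulVec u (star u)) := by
    simp only [sub_mul, mul_sub, mul_one, one_mul, smul_mul_assoc, mul_smul_comm, vecMulVec_mul,
      mul_vecMulVec, hD, hD', vecMulVec_smul, smul_vecMulVec]
  rw [this, mul_assoc, reflection_mul_self h, mul_one]

/-- Conjugating a diagonal matrix by a unitary acting in the `(p, q)` coordinate plane moves the
`q`-th eigenvector to an arbitrary direction of that plane, up to a phase. -/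
theorem exists_unitary_conj_diagonal (a : n → ℝ) {p q : n} (hpq : p ≠ q) (t : ℝ) {w : ℂ}
    (hw : star w * w = 1) :
    ∃ V ∈ unitaryGroup n ℂ, V * diagonal (fun i => (a i : ℂ)) * Vᴴ =
      diagonal (fun i => (Function.update a q (a p) i : ℂ)) + ((a q - a p : ℝ) : ℂ) •
        vecMulVec (Pi.single q ((1 - t ^ 2 : ℝ) / (1 + t ^ 2 : ℝ) : ℂ) -
            Pi.single p ((2 * t : ℝ) / (1 + t ^ 2 : ℝ) * w))
          (star (Pi.single q ((1 - t ^ 2 : ℝ) / (1 + t ^ 2 : ℝ) : ℂ) -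
            Pi.single p ((2 * t : ℝ) / (1 + t ^ 2 : ℝ) * w))) := by
  have ht : (1 + (t : ℂ) ^ 2) ≠ 0 := by
    norm_cast; positivity
  set u : n → ℂ := Pi.single p w + Pi.single q (t : ℂ) with hu
  set κ : ℝ := 2 / (1 + t ^ 2) with hκ
  have hup : u p = w := by simp [hu, hpq]
  have huq : u q = t := by simp [hu, hpq.symm]
  have hu0 : ∀ i, i ≠ p → i ≠ q → u i = 0 := by intro i h1 h2; simp [hu, h1, h2]
  have h : (κ : ℂ) * (star u ⬝ᵥ u) = 2 := by
    have : star u ⬝ᵥ u = 1 + (t : ℂ) ^ 2 := by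
      nth_rewrite 2 [hu]
      rw [dotProduct_add, dotProduct_single, dotProduct_single, Pi.star_apply, Pi.star_apply,
        hup, huq, hw]
      simp [sq]
    rw [this, hκ]; push_cast; field_simp
  set V : Matrix n n ℂ := 1 - (κ : ℂ) • vecMulVec u (star u) with hV
  have hVH : Vᴴ = V := reflection_isHermitian u κ
  have hVV : V * V = 1 := reflection_mul_self h
  refine ⟨V, ?_, ?_⟩
  · rw [mem_unitaryGroup_iff, star_eq_conjTranspose, hVH, hVV]
  have hVe : V *ᵥ Pi.single q 1 = Pi.single q ((1 - t ^ 2 : ℝ) / (1 + t ^ 2 : ℝ) : ℂ) -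
            Pi.single p ((2 * t : ℝ) / (1 + t ^ 2 : ℝ) * w) := by
    ext i
    simp only [hV, sub_mulVec, one_mulVec, smul_mulVec, vecMulVec_mulVec, dotProduct_single,
      Pi.star_apply, huq, Pi.sub_apply, Pi.smul_apply, hκ]
    by_cases hi : i = q
    · subst hi
      simp [huq, hpq.symm]; field_simp; ring
    · by_cases hi' : i = p
      · subst hi'
        simp [hup, hpq]; field_simp
      · simp [hu0 i hi' hi, hi, hi']
  rw [hVH, diagonal_eq_diagonal_update_add a p q, mul_add, add_mul]
  congr 1
  · apply reflection_conj h (a := (a p : ℂ))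
    · ext i
      rw [mulVec_diagonal]
      by_cases hi : i = q
      · simp [hi]
      · by_cases hi' : i = p
        · simp [hi', hpq]
        · simp [hu0 i hi' hi]
    · ext i
      rw [vecMul_diagonal]
      by_cases hi : i = q
      · simp [hi, mul_comm]
      · by_cases hi' : i = p
        · simp [hi', hpq, mul_comm]
        · simp [hu0 i hi' hi]
  · rw [mul_smul_comm, smul_mul_assoc, mul_vecMulVec, vecMulVec_mul, hVe, ← hVe, star_mulVec, hVH]

theorem nonpos_of_one_sub_sq_mul_le {r s : ℝ} (h : ∀ t : ℝ, 0 < t → t < 1 → (1 - t ^ 2) * r ≤ t * s) : r ≤ 0 := by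
  by_contra! hr
  have h1 := h (min (1/2) (r / (4 * (|s| + 1)))) (by positivity) (by
    apply lt_of_le_of_lt (min_le_left _ _); norm_num)
  set t := min (1/2) (r / (4 * (|s| + 1)))
  have ht : t ≤ 1/2 := min_le_left _ _
  have ht2 : t ≤ r / (4 * (|s| + 1)) := min_le_right _ _
  have ht0 : 0 < t := by positivity
  rw [le_div_iff₀ (by positivity)] at ht2
  have : t * s ≤ t * |s| := by gcongr; exact le_abs_self s
  have h2 : t * |s| ≤ r / 4 := by linarith
  have h3 : 3 / 4 * r ≤ (1 - t ^ 2) * r := by gcongr; nlinarith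
  linarith

theorem apply_eq_zero_of_quadratic_le {H : Matrix n n ℂ} (hH : H.IsHermitian) {p q : n}
    (h : ∀ (t : ℝ) (w : ℂ), star w * w = 1 →
      (star (Pi.single q ((1 - t ^ 2 : ℝ) / (1 + t ^ 2 : ℝ) : ℂ) -
            Pi.single p ((2 * t : ℝ) / (1 + t ^ 2 : ℝ) * w)) ⬝ᵥ H *ᵥ
        (Pi.single q ((1 - t ^ 2 : ℝ) / (1 + t ^ 2 : ℝ) : ℂ) -
            Pi.single p ((2 * t : ℝ) / (1 + t ^ 2 : ℝ) * w))).re ≤ (H q q).re) :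
    H p q = 0 ∧ (H p p).re ≤ (H q q).re := by
  have hqp : H q p = star (H p q) := (hH.apply q p).symm
  have key : ∀ (t : ℝ) (w : ℂ), star w * w = 1 →
      (1 - t ^ 2) ^ 2 * (H q q).re - 4 * t * (1 - t ^ 2) * (star w * H p q).re
        + 4 * t ^ 2 * (H p p).re ≤ (1 + t ^ 2) ^ 2 * (H q q).re := by
    intro t w hw
    have h1 := h t w hw
    have ht : (0:ℝ) < 1 + t ^ 2 := by positivity
    rw [star_sub, mulVec_sub, sub_dotProduct, dotProduct_sub, dotProduct_sub] at h1
    have e : ∀ (i j : n) (x y : ℂ), star (Pi.single i x) ⬝ᵥ H *ᵥ (Pi.single j y) =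
        star x * H i j * y := by
      intro i j x y
      simp [mulVec_single, mul_comm]
    have hw' : w.re * w.re + w.im * w.im = 1 := by
      have := congrArg Complex.re hw
      simpa using this
    simp only [e, hqp] at h1
    rw [← Complex.ofReal_div, ← Complex.ofReal_div] at h1
    set α := (1 - t ^ 2) / (1 + t ^ 2)
    set β := (2 * t) / (1 + t ^ 2)
    have hα : 1 - t ^ 2 = α * (1 + t ^ 2) := by simp only [α]; field_simp
    have hβ : 2 * t = β * (1 + t ^ 2) := by simp only [β]; field_simp
    simp [Complex.mul_re, Complex.mul_im] at h1
    have e1 : 4 * t * (1 - t ^ 2) = 2 * (2 * t) * (1 - t ^ 2) := by ring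
    have e2 : 4 * t ^ 2 = (2 * t) ^ 2 := by ring
    rw [e1, e2, hα, hβ]
    have : α ^ 2 * (H q q).re - 2 * β * α * (star w * H p q).re + β ^ 2 * (H p p).re
       ≤ (H q q).re := by
      simp only [Complex.mul_re, Complex.star_def, Complex.conj_re, Complex.conj_im]
      linear_combination h1 - (β ^ 2 * (H p p).re) * hw'
    nlinarith [mul_le_mul_of_nonneg_left this (sq_nonneg (1 + t ^ 2))]
  have hre : ∀ w : ℂ, star w * w = 1 → 0 ≤ (star w * H p q).re := by
    intro w hw
    rw [← neg_nonpos]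
    apply nonpos_of_one_sub_sq_mul_le (s := (H q q).re - (H p p).re)
    intro t ht ht'
    have := key t w hw
    have : 4 * t * ((1 - t ^ 2) * -(star w * H p q).re) ≤
      4 * t * (t * ((H q q).re - (H p p).re)) := by linarith
    exact le_of_mul_le_mul_left this (by positivity)
  constructor
  · have h1 := hre 1 (by simp)
    have h2 := hre (-1) (by simp)
    have h3 := hre Complex.I (by simp)
    have h4 := hre (-Complex.I) (by simp)
    simp at h1 h2 h3 h4
    apply Complex.ext <;> simp <;> linarith
  · have := key 1 1 (by simp)
    norm_num at this
    linarith

theorem det_add_vecMulVec {M : Matrix n n ℂ} (hM : IsUnit M.det) (δ : ℂ) (v w : n → ℂ) :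
    (M + δ • vecMulVec v w).det = M.det * (1 + δ * (w ⬝ᵥ M⁻¹ *ᵥ v)) := by
  have := det_add_replicateCol_mul_replicateRow (ι := Unit) hM (δ • v) w
  rw [← smul_vecMulVec, vecMulVec_eq Unit, this]
  congr 1
  simp [Matrix.mul_assoc, Matrix.mul_apply, dotProduct, mulVec, Finset.mul_sum]

theorem inv_apply_eq_zero_of_det_max {a : n → ℝ} (ha : ∀ i, 0 < a i) {B : Matrix n n ℂ}
    (hB : B.PosSemidef)
    (hmax : ∀ V ∈ unitaryGroup n ℂ,
      (det (V * diagonal (fun i => (a i : ℂ)) * Vᴴ + B)).re ≤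
        (det (diagonal (fun i => (a i : ℂ)) + B)).re)
    {p q : n} (hpq : a p < a q) :
    (diagonal (fun i => (a i : ℂ)) + B)⁻¹ q p = 0 ∧
      ((diagonal (fun i => (Function.update a q (a p) i : ℂ)) + B)⁻¹ p p).re ≤
        ((diagonal (fun i => (Function.update a q (a p) i : ℂ)) + B)⁻¹ q q).re := by
  have hne : p ≠ q := by rintro rfl; exact lt_irrefl _ hpq
  have ha' : ∀ i, 0 < Function.update a q (a p) i := by
    intro i
    by_cases hi : i = q
    · subst hi; simpa using ha p
    · simpa [hi] using ha i
  have hM₀ := posDef_diagonal_add ha' hB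
  have hM := posDef_diagonal_add ha hB
  set M₀ := diagonal (fun i => (Function.update a q (a p) i : ℂ)) + B with hM₀def
  set M := diagonal (fun i => (a i : ℂ)) + B with hMdef
  have hMM₀ : M = M₀ + ((a q - a p : ℝ) : ℂ) •
        vecMulVec (Pi.single q 1) (star (Pi.single q 1)) := by
    rw [hMdef, diagonal_eq_diagonal_update_add a p q, hM₀def, add_right_comm]
  have hdet := hM₀.det_pos
  have hu : IsUnit M₀.det := hdet.ne'.isUnit
  obtain ⟨hre, him⟩ := Complex.pos_iff.1 hdet
  obtain ⟨h0, hle⟩ := apply_eq_zero_of_quadratic_le hM₀.inv.isHermitian (p := p) (q := q) (by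
    intro t w hw
    obtain ⟨V, hV, hVA⟩ := exists_unitary_conj_diagonal a hne t hw
    have h1 := hmax V hV
    rw [hVA, add_right_comm, hMM₀, det_add_vecMulVec hu, det_add_vecMulVec hu] at h1
    simp only [Complex.mul_re, ← him, zero_mul, sub_zero, Complex.add_re, Complex.ofReal_re,
      Complex.ofReal_im] at h1
    have h2 := le_of_mul_le_mul_left (le_of_add_le_add_left (le_of_mul_le_mul_left h1 hre))
      (sub_pos.2 hpq)
    simpa using h2)
  refine ⟨?_, hle⟩
  have hqp : M₀⁻¹ q p = 0 := by
    rw [← hM₀.inv.isHermitian.apply, h0, star_zero]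
  have hMu : IsUnit M.det := hM.det_pos.ne'.isUnit
  have hres : M⁻¹ + ((a q - a p : ℝ) : ℂ) • (M⁻¹ *
      (vecMulVec (Pi.single q 1) (star (Pi.single q 1))) * M₀⁻¹) = M₀⁻¹ := by
    have h3 : M⁻¹ * M * M₀⁻¹ = M₀⁻¹ := by rw [nonsing_inv_mul _ hMu, one_mul]
    conv_lhs at h3 => rw [mul_assoc]; rhs; rw [hMM₀, add_mul, mul_nonsing_inv _ hu]
    nth_rewrite 2 [← h3]
    rw [mul_add, mul_one, smul_mul_assoc, mul_smul_comm, mul_assoc]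
  have h4 := congrFun (congrFun hres q) p
  simpa [mul_vecMulVec, vecMulVec_mul, vecMulVec_apply, hqp, ← Pi.single_star] using h4

theorem exists_antitone_eq_diagonal_of_det_max {n : Type*} [Fintype n] [LinearOrder n]
    {a : n → ℝ} (ha : ∀ i, 0 < a i) (hamono : StrictMono a) {B : Matrix n n ℂ}
    (hB : B.PosSemidef)
    (hmax : ∀ V ∈ unitaryGroup n ℂ,
      (det (V * diagonal (fun i => (a i : ℂ)) * Vᴴ + B)).re ≤
        (det (diagonal (fun i => (a i : ℂ)) + B)).re) :
    ∃ b : n → ℝ, Antitone b ∧ B = diagonal (fun i => (b i : ℂ)) := by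
  have hM := posDef_diagonal_add ha hB
  have hinv : ∀ i j, i ≠ j → (diagonal (fun i => (a i : ℂ)) + B)⁻¹ i j = 0 := by
    intro i j hij
    rcases lt_or_gt_of_ne hij with h | h
    · rw [← hM.inv.isHermitian.apply, (inv_apply_eq_zero_of_det_max ha hB hmax (hamono h)).1,
        star_zero]
    · exact (inv_apply_eq_zero_of_det_max ha hB hmax (hamono h)).1
  obtain ⟨b, hb, rfl⟩ : ∃ b : n → ℝ, (∀ i, 0 ≤ b i) ∧ B = diagonal (fun i => (b i : ℂ)) := by
    refine ⟨fun i => (B i i).re, fun i => (Complex.nonneg_iff.1 (hB.diag_nonneg (i := i))).1, ?_⟩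
    have h1 := (isDiag_iff_diagonal_diag _).1 (fun i j h => hinv i j h :
      (diagonal (fun i => (a i : ℂ)) + B)⁻¹.IsDiag)
    have h2 := congrArg (·⁻¹) h1
    simp only [inv_diagonal, nonsing_inv_nonsing_inv _ hM.det_pos.ne'.isUnit] at h2
    ext i j
    by_cases hij : i = j
    · subst hij
      rw [diagonal_apply_eq]
      exact (hB.isHermitian.coe_re_apply_self i).symm
    · have := congrFun (congrFun h2 i) j
      simpa [hij] using this.symm
  refine ⟨b, ?_, rfl⟩
  intro p q hpq
  rcases hpq.eq_or_lt with rfl | h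
  · rfl
  have h1 := (inv_apply_eq_zero_of_det_max ha hB hmax (hamono h)).2
  have hinv' : ∀ i, (diagonal (fun i => (Function.update a q (a p) i : ℂ)) +
      diagonal (fun i => (b i : ℂ)))⁻¹ i i = (((Function.update a q (a p) i + b i)⁻¹ : ℝ) : ℂ) := by
    have hpos : ∀ i, 0 < Function.update a q (a p) i + b i := by
      intro i
      by_cases hi : i = q
      · subst hi; simpa using add_pos_of_pos_of_nonneg (ha p) (hb i)
      · simpa [hi] using add_pos_of_pos_of_nonneg (ha i) (hb i)
    have hprod : (diagonal (fun i => (Function.update a q (a p) i : ℂ)) +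
        diagonal (fun i => (b i : ℂ))) *
        diagonal (fun i => (((Function.update a q (a p) i + b i)⁻¹ : ℝ) : ℂ)) = 1 := by
      rw [diagonal_add, diagonal_mul_diagonal, ← diagonal_one]
      congr 1
      ext i
      rw [← Complex.ofReal_add, ← Complex.ofReal_mul, mul_inv_cancel₀ (hpos i).ne',
        Complex.ofReal_one]
    intro i
    rw [inv_eq_right_inv hprod, diagonal_apply_eq]
  rw [hinv', hinv', Complex.ofReal_re, Complex.ofReal_re] at h1
  simp [h.ne] at h1
  rw [inv_le_inv₀] at h1
  · linarith
  · linarith [ha p, hb p]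
  · linarith [ha p, hb q]

theorem exists_unitary_det_max (A B : Matrix n n ℂ) :
    ∃ W ∈ unitaryGroup n ℂ, ∀ V ∈ unitaryGroup n ℂ,
      (det (V * A * Vᴴ + B)).re ≤ (det (W * A * Wᴴ + B)).re := by
  have hK : IsCompact (unitaryGroup n ℂ : Set (Matrix n n ℂ)) := by
    have h1 : IsCompact (Set.univ.pi fun _ => Set.univ.pi fun _ => Metric.closedBall 0 1 :
      Set (n → n → ℂ)) :=
      isCompact_univ_pi fun _ => isCompact_univ_pi fun _ => isCompact_closedBall 0 1
    refine h1.of_isClosed_subset (isClosed_unitary (R := Matrix n n ℂ)) ?_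
    intro U hU
    simp only [Set.mem_univ_pi, mem_closedBall_zero_iff]
    exact fun i j => entry_norm_bound_of_unitary hU i j
  obtain ⟨W, hW, h⟩ := hK.exists_isMaxOn ⟨1, one_mem _⟩
    (f := fun V => (det (V * A * Vᴴ + B)).re) (by fun_prop)
  exact ⟨W, hW, fun V hV => h hV⟩

theorem eq_of_antitone_of_unitary_conj {N : ℕ} {b s : Fin N → ℝ} (hb : Antitone b)
    (hs : Antitone s) {W : Matrix (Fin N) (Fin N) ℂ} (hW : W ∈ unitaryGroup (Fin N) ℂ)
    (h : Wᴴ * diagonal (fun i => (s i : ℂ)) * W = diagonal (fun i => (b i : ℂ))) : b = s := by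
  have hW' : W * Wᴴ = 1 := mem_unitaryGroup_iff.1 hW
  have h1 := congrArg charpoly h
  rw [charpoly_mul_comm, ← mul_assoc, hW', one_mul, charpoly_diagonal, charpoly_diagonal] at h1
  have h2 := congrArg Polynomial.roots h1
  have h3 : ∀ f : Fin N → ℝ, (∏ i, (Polynomial.X - Polynomial.C (f i : ℂ))).roots =
      (Finset.univ.val.map f).map (fun x : ℝ => (x : ℂ)) := by
    intro f
    rw [← Polynomial.roots_multiset_prod_X_sub_C (Multiset.map _ (Multiset.map f univ.val))]
    rw [Multiset.map_map, Multiset.map_map]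
    rfl
  rw [h3, h3] at h2
  have h4 := Multiset.map_injective Complex.ofReal_injective h2
  have h5 : (List.ofFn s).Perm (List.ofFn b) := by
    rw [← Multiset.coe_eq_coe]
    simpa [Fin.univ_val_map] using h4
  exact (List.ofFn_injective (h5.eq_of_sortedGE hs.sortedGE_ofFn hb.sortedGE_ofFn)).symm

theorem det_diagonal_add_le {N : ℕ} {a s : Fin N → ℝ} (ha : ∀ i, 0 < a i)
    (hamono : StrictMono a) (hs0 : ∀ i, 0 ≤ s i) (hs : Antitone s)
    {U : Matrix (Fin N) (Fin N) ℂ} (hU : U ∈ unitaryGroup (Fin N) ℂ) :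
    (det (diagonal (fun i => (a i : ℂ)) + Uᴴ * diagonal (fun i => (s i : ℂ)) * U)).re ≤
      ∏ i, (a i + s i) := by
  set A := diagonal (fun i => (a i : ℂ))
  set S := diagonal (fun i => (s i : ℂ)) with hS
  have hconj : ∀ V ∈ unitaryGroup (Fin N) ℂ, ∀ X, det (X + Vᴴ * S * V) = det (V * X * Vᴴ + S) := by
    intro V hV X
    have h1 : V * Vᴴ = 1 := mem_unitaryGroup_iff.1 hV
    have : V * X * Vᴴ + S = V * (X + Vᴴ * S * V) * Vᴴ := by
      rw [mul_add, add_mul]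
      congr 1
      simp only [← mul_assoc, h1, one_mul]
      rw [mul_assoc, h1, mul_one]
    rw [this, det_mul_comm, ← mul_assoc, ← star_eq_conjTranspose, mem_unitaryGroup_iff'.1 hV, one_mul]
  obtain ⟨W, hW, hmax⟩ := exists_unitary_det_max A S
  have hSpsd : S.PosSemidef := by
    rw [hS, posSemidef_diagonal_iff]
    intro i
    exact_mod_cast hs0 i
  obtain ⟨b, hb, hBb⟩ := exists_antitone_eq_diagonal_of_det_max ha hamono
    (hSpsd.conjTranspose_mul_mul_same W) (by
      intro V hV
      rw [hconj W hW, hconj W hW]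
      have := hmax (W * V) (mul_mem hW hV)
      simpa [conjTranspose_mul, mul_assoc] using this)
  have hbs := eq_of_antitone_of_unitary_conj hb hs hW hBb
  rw [hconj U hU]
  refine (hmax U hU).trans (le_of_eq ?_)
  rw [← hconj W hW, hBb, hbs, diagonal_add, det_diagonal]
  norm_cast

theorem det_one_add_diag_conj_re_le_of_pos {N : ℕ} {c s : Fin N → ℝ} (hc0 : ∀ i, 0 < c i)
    (hc : StrictAnti c) (hs0 : ∀ i, 0 ≤ s i) (hs : Antitone s)
    {U : Matrix (Fin N) (Fin N) ℂ} (hU : U ∈ unitaryGroup (Fin N) ℂ) :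
    (det (1 + diagonal (fun i => (c i : ℂ)) * Uᴴ * diagonal (fun i => (s i : ℂ)) * U)).re ≤
      ∏ i, (1 + c i * s i) := by
  have hfac : 1 + diagonal (fun i => (c i : ℂ)) * Uᴴ * diagonal (fun i => (s i : ℂ)) * U =
      diagonal (fun i => (c i : ℂ)) * (diagonal (fun i => (((c i)⁻¹ : ℝ) : ℂ)) +
        Uᴴ * diagonal (fun i => (s i : ℂ)) * U) := by
    rw [mul_add, diagonal_mul_diagonal]
    simp [mul_assoc, (hc0 _).ne']
  have h := det_diagonal_add_le (fun i => inv_pos.2 (hc0 i))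
    (fun i j hij => (inv_lt_inv₀ (hc0 i) (hc0 j)).2 (hc hij)) hs0 hs hU
  rw [hfac, det_mul, det_diagonal, ← Complex.ofReal_prod, Complex.re_ofReal_mul]
  calc _ ≤ (∏ i, c i) * ∏ i, ((c i)⁻¹ + s i) :=
        mul_le_mul_of_nonneg_left h (Finset.prod_nonneg fun i _ => (hc0 i).le)
    _ = _ := by
        rw [← Finset.prod_mul_distrib]
        refine Finset.prod_congr rfl fun i _ => ?_
        rw [mul_add, mul_inv_cancel₀ (hc0 i).ne']

theorem det_one_add_diag_conj_re_le {N : ℕ} {c s : Fin N → ℝ} (hc0 : ∀ i, 0 ≤ c i)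
    (hc : Antitone c) (hs0 : ∀ i, 0 ≤ s i) (hs : Antitone s)
    {U : Matrix (Fin N) (Fin N) ℂ} (hU : U ∈ unitaryGroup (Fin N) ℂ) :
    (det (1 + diagonal (fun i => (c i : ℂ)) * Uᴴ * diagonal (fun i => (s i : ℂ)) * U)).re ≤
      ∏ i, (1 + c i * s i) := by
  set d : ℝ → Fin N → ℝ := fun ε i => c i + ε * (N - i)
  have hL : Continuous fun ε : ℝ =>
      (det (1 + diagonal (fun i => (d ε i : ℂ)) * Uᴴ * diagonal (fun i => (s i : ℂ)) * U)).re := by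
    fun_prop
  have hR : Continuous fun ε : ℝ => ∏ i, (1 + d ε i * s i) := by fun_prop
  have hlim : ∀ f : ℝ → ℝ, Continuous f →
      Filter.Tendsto f (nhdsWithin 0 (Set.Ioi 0)) (nhds (f 0)) :=
    fun f hf => (hf.tendsto 0).mono_left nhdsWithin_le_nhds
  have := le_of_tendsto_of_tendsto (hlim _ hL) (hlim _ hR) (by
    filter_upwards [self_mem_nhdsWithin] with ε (hε : 0 < ε)
    apply det_one_add_diag_conj_re_le_of_pos _ _ hs0 hs hU
    · intro i
      have : (i : ℝ) < N := by exact_mod_cast i.2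
      have := mul_pos hε (sub_pos.2 this)
      linarith [hc0 i]
    · intro i j hij
      have h1 : (i : ℝ) < j := by exact_mod_cast hij
      have h2 := mul_lt_mul_of_pos_left h1 hε
      have h3 := hc hij.le
      simp only [d]
      linarith)
  simpa [d] using this

end

/-- **Theorem 3 of the paper.** For an `N × N` complex unitary matrix `U` and nonnegative
nonincreasing real vectors `c`, `s`, the determinant `det (I + diag c * Uᴴ * diag s * U)` is
real and at most `∏ i (1 + cᵢ sᵢ)`, the latter being `det (I + Uᴴ * diag c * diag s * U)`. -/
theorem det_one_add_diag_conj_le (N : ℕ) (hN : 1 ≤ N)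
    (U : Matrix (Fin N) (Fin N) ℂ) (hU : Uᴴ * U = 1) (hU' : U * Uᴴ = 1)
    (c s : Fin N → ℝ) (hc0 : ∀ i, 0 ≤ c i) (hs0 : ∀ i, 0 ≤ s i)
    (hc : Antitone c) (hs : Antitone s) :
    (Matrix.det (1 + Matrix.diagonal (fun i => (c i : ℂ)) * Uᴴ *
        Matrix.diagonal (fun i => (s i : ℂ)) * U)).im = 0 ∧
    (Matrix.det (1 + Matrix.diagonal (fun i => (c i : ℂ)) * Uᴴ *
        Matrix.diagonal (fun i => (s i : ℂ)) * U)).re ≤ ∏ i, (1 + c i * s i) ∧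
    ((∏ i, (1 + c i * s i) : ℝ) : ℂ) =
      Matrix.det (1 + Uᴴ * Matrix.diagonal (fun i => (c i : ℂ)) *
        Matrix.diagonal (fun i => (s i : ℂ)) * U) := by
  refine ⟨?_, det_one_add_diag_conj_re_le hc0 hc hs0 hs (mem_unitaryGroup_iff.2 hU'), ?_⟩
  · rw [← Complex.conj_eq_iff_im, ← Complex.star_def, ← det_conjTranspose]
    have hdiag : ∀ f : Fin N → ℝ,
        (diagonal fun i => (f i : ℂ))ᴴ = diagonal fun i => (f i : ℂ) := by
      intro f
      rw [diagonal_conjTranspose]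
      congr 1
      ext i
      simp
    rw [conjTranspose_add, conjTranspose_mul, conjTranspose_mul, conjTranspose_mul, hdiag, hdiag,
      conjTranspose_conjTranspose, conjTranspose_one, ← mul_assoc, ← mul_assoc,
      det_one_add_mul_comm, ← mul_assoc, ← mul_assoc]
  · rw [mul_assoc, mul_assoc, det_one_add_mul_comm, mul_assoc, mul_assoc, hU', mul_one,
      diagonal_mul_diagonal, ← diagonal_one, diagonal_add, det_diagonal]
    push_cast
    rfl
end

section
/- Let N ≥ 1, let U be an N×N complex unitary matrix, and let c, s ∈ ℝ^N with c₁ ≥ c₂ ≥ … ≥ c_N > 0 and s₁ ≥ s₂ ≥ … ≥ s_N ≥ 0. Writing c⁻¹ for the vector (c₁⁻¹, …, c_N⁻¹), the determinant det(U diag(c⁻¹) Uᴴ + diag(s)) is a positive real number and satisfies det(U diag(c⁻¹) Uᴴ + diag(s)) ≤ ∏_{i=1}^N (c_i⁻¹ + s_i). -/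
open Matrix Finset

/-- A Hermitian matrix is unitarily diagonalizable with its eigenvalues in nonincreasing order. -/
lemma Matrix.IsHermitian.exists_unitary_antitone_diagonal {n : ℕ} {H : Matrix (Fin n) (Fin n) ℂ}
    (hH : H.IsHermitian) :
    ∃ (V : Matrix (Fin n) (Fin n) ℂ) (b : Fin n → ℝ), Vᴴ * V = 1 ∧ V * Vᴴ = 1 ∧ Antitone b ∧
      H = V * diagonal (fun i => (b i : ℂ)) * Vᴴ := by
  let σ := Tuple.sort (fun i => -hH.eigenvalues i)
  have hσ : Antitone (fun i => hH.eigenvalues (σ i)) := by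
    intro i j hij
    have := Tuple.monotone_sort (fun i => -hH.eigenvalues i) hij
    simpa using this
  let E : Matrix (Fin n) (Fin n) ℂ := hH.eigenvectorUnitary
  have hE : Eᴴ * E = 1 := Unitary.coe_star_mul_self hH.eigenvectorUnitary
  have hE' : E * Eᴴ = 1 := Unitary.coe_mul_star_self hH.eigenvectorUnitary
  refine ⟨E.submatrix id σ, fun i => hH.eigenvalues (σ i), ?_, ?_, hσ, ?_⟩
  · rw [conjTranspose_submatrix, ← submatrix_mul _ _ _ _ _ Function.bijective_id, hE,
      submatrix_one_equiv]
  · rw [conjTranspose_submatrix, ← submatrix_mul _ _ _ _ _ σ.bijective, hE', submatrix_id_id]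
  · have hd : diagonal (fun i => (hH.eigenvalues (σ i) : ℂ)) =
        (diagonal (fun i => (hH.eigenvalues i : ℂ))).submatrix σ σ :=
      (submatrix_diagonal_equiv (fun i => (hH.eigenvalues i : ℂ)) σ).symm
    rw [hd, conjTranspose_submatrix, ← submatrix_mul _ _ _ _ _ σ.bijective,
      ← submatrix_mul _ _ _ _ _ σ.bijective, submatrix_id_id]
    have h := hH.spectral_theorem
    rwa [Unitary.conjStarAlgAut_apply] at h

lemma star_dotProduct_diagonal_ofReal_mulVec {ι : Type*} [Fintype ι] [DecidableEq ι]
    (d : ι → ℝ) (y : ι → ℂ) :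
    star y ⬝ᵥ (diagonal (fun i => (d i : ℂ)) *ᵥ y) = ((∑ i, d i * ‖y i‖ ^ 2 : ℝ) : ℂ) := by
  simp only [dotProduct, mulVec_diagonal, Complex.ofReal_sum, Complex.ofReal_mul,
    Complex.ofReal_pow, Pi.star_apply]
  refine Finset.sum_congr rfl fun i _ => ?_
  rw [← Complex.conj_mul', starRingEnd_apply]
  ring

/-- Cauchy interlacing (upper half) for the compression of a real diagonal matrix. -/
lemma compression_eigenvalue_le {n : ℕ} (W : Matrix (Fin (n + 1)) (Fin n) ℂ) (hW : Wᴴ * W = 1)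
    {b : Fin (n + 1) → ℝ} {b' : Fin n → ℝ} (hb : Antitone b) (hb' : Antitone b')
    (h : Wᴴ * diagonal (fun i => (b i : ℂ)) * W = diagonal (fun i => (b' i : ℂ))) (i : Fin n) :
    b' i ≤ b i.castSucc := by
  let M : Matrix (Fin n) (Fin n) ℂ := of fun j =>
    if j < i then W j.castSucc else if j = i then 0 else Pi.single j 1
  have hM : M.det = 0 := det_eq_zero_of_row_eq_zero i fun k => by simp [M]
  obtain ⟨y, hy0, hy⟩ := exists_mulVec_eq_zero_iff.mpr hM
  have hlow : ∀ j, j < i → (W *ᵥ y) j.castSucc = 0 := fun j hj => by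
    have := congrFun hy j
    simpa [M, mulVec, hj] using this
  have hhigh : ∀ j, i < j → y j = 0 := fun j hj => by
    have := congrFun hy j
    simpa [M, mulVec, hj.not_gt, hj.ne'] using this
  have key (d : Fin (n + 1) → ℝ) (d' : Fin n → ℝ)
      (hd : Wᴴ * diagonal (fun i => (d i : ℂ)) * W = diagonal (fun i => (d' i : ℂ))) :
      ∑ k, d k * ‖(W *ᵥ y) k‖ ^ 2 = ∑ j, d' j * ‖y j‖ ^ 2 := by
    have := star_dotProduct_diagonal_ofReal_mulVec d' y
    rw [← hd, ← mulVec_mulVec, ← mulVec_mulVec, dotProduct_mulVec, ← star_mulVec,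
      star_dotProduct_diagonal_ofReal_mulVec] at this
    exact_mod_cast this
  have hq := key b b' h
  have hn : ∑ k, ‖(W *ᵥ y) k‖ ^ 2 = ∑ j, ‖y j‖ ^ 2 := by
    simpa using key 1 1 (by simpa using hW)
  have hpos : 0 < ∑ j, ‖y j‖ ^ 2 := by
    obtain ⟨j, hj⟩ := Function.ne_iff.mp hy0
    exact Finset.sum_pos' (fun _ _ => by positivity)
      ⟨j, mem_univ j, pow_pos (norm_pos_iff.mpr hj) 2⟩
  refine le_of_mul_le_mul_right ?_ hpos
  calc b' i * ∑ j, ‖y j‖ ^ 2 ≤ ∑ j, b' j * ‖y j‖ ^ 2 := by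
        rw [mul_sum]
        refine sum_le_sum fun j _ => ?_
        rcases le_or_gt j i with hj | hj
        · exact mul_le_mul_of_nonneg_right (hb' hj) (by positivity)
        · simp [hhigh j hj]
    _ = ∑ k, b k * ‖(W *ᵥ y) k‖ ^ 2 := hq.symm
    _ ≤ b i.castSucc * ∑ k, ‖(W *ᵥ y) k‖ ^ 2 := by
        rw [mul_sum]
        refine sum_le_sum fun k _ => ?_
        rcases le_or_gt i.castSucc k with hk | hk
        · exact mul_le_mul_of_nonneg_right (hb hk) (by positivity)
        · have hk' : (k : ℕ) < i := hk
          have := hlow ⟨k, by omega⟩ hk'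
          rw [show Fin.castSucc ⟨(k : ℕ), by omega⟩ = k from rfl] at this
          simp [this]
    _ = b i.castSucc * ∑ j, ‖y j‖ ^ 2 := by rw [hn]

open scoped ComplexOrder in
lemma posDef_unitary_conj_diagonal {ι : Type*} [Fintype ι] [DecidableEq ι] {U : Matrix ι ι ℂ}
    (hU' : U * Uᴴ = 1) {a : ι → ℝ} (ha : ∀ i, 0 < a i) :
    (U * diagonal (fun i => (a i : ℂ)) * Uᴴ).PosDef := by
  refine (PosDef.diagonal fun i => by exact_mod_cast ha i).mul_mul_conjTranspose_same ?_
  exact Function.LeftInverse.injective (g := fun v => v ᵥ* Uᴴ) fun v => by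
    simp [vecMul_vecMul, hU']

/-- Splitting off an invertible summand that is unitarily diagonalized. -/
lemma det_unitary_conj_diagonal_add {ι : Type*} [Fintype ι] [DecidableEq ι] {U : Matrix ι ι ℂ}
    (hU : Uᴴ * U = 1) (hU' : U * Uᴴ = 1) {a : ι → ℝ} (ha : ∀ i, 0 < a i) (S : Matrix ι ι ℂ) :
    (U * diagonal (fun i => (a i : ℂ)) * Uᴴ + S).det =
      ((∏ i, a i : ℝ) : ℂ) * (1 + U * diagonal (fun i => (((a i)⁻¹ : ℝ) : ℂ)) * Uᴴ * S).det := by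
  have hdet : (U * diagonal (fun i => (a i : ℂ)) * Uᴴ).det = ((∏ i, a i : ℝ) : ℂ) := by
    rw [det_mul_right_comm, hU', one_mul, det_diagonal, Complex.ofReal_prod]
  have hinv : U * diagonal (fun i => (a i : ℂ)) * Uᴴ *
      (U * diagonal (fun i => (((a i)⁻¹ : ℝ) : ℂ)) * Uᴴ) = 1 := by
    have hd : diagonal (fun i => (a i : ℂ)) * diagonal (fun i => (((a i)⁻¹ : ℝ) : ℂ)) = 1 := by
      rw [diagonal_mul_diagonal, ← diagonal_one]
      congr 1
      funext i
      rw [← Complex.ofReal_mul, mul_inv_cancel₀ (ha i).ne', Complex.ofReal_one]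
    calc _ = U * (diagonal (fun i => (a i : ℂ)) * (Uᴴ * U) *
          diagonal (fun i => (((a i)⁻¹ : ℝ) : ℂ))) * Uᴴ := by simp only [Matrix.mul_assoc]
      _ = 1 := by rw [hU, Matrix.mul_one, hd, Matrix.mul_one, hU']
  rw [← hdet, ← det_mul, Matrix.mul_add, Matrix.mul_one, ← Matrix.mul_assoc, hinv, Matrix.one_mul]

open scoped ComplexOrder in
/-- Fiedler's determinant inequality for a positive definite matrix with eigenvalues `a` and a
nonnegative diagonal matrix with oppositely ordered entries `s`. -/
lemma det_unitary_conj_diagonal_add_diagonal_le : ∀ (n : ℕ) (U : Matrix (Fin n) (Fin n) ℂ)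
    (_ : Uᴴ * U = 1) (_ : U * Uᴴ = 1) (a s : Fin n → ℝ) (_ : ∀ i, 0 < a i) (_ : ∀ i, 0 ≤ s i)
    (_ : Monotone a) (_ : Antitone s),
    (U * diagonal (fun i => (a i : ℂ)) * Uᴴ + diagonal (fun i => (s i : ℂ))).det ≤
      ((∏ i, (a i + s i) : ℝ) : ℂ)
  | 0, _, _, _, _, _, _, _, _, _ => by simp
  | n + 1, U, hU, hU', a, s, ha0, hs0, ha, hs => by
    set t := s (Fin.last n)
    let A : Fin (n + 1) → ℝ := fun i => a i + t
    have hA0 (i) : 0 < A i := add_pos_of_pos_of_nonneg (ha0 i) (hs0 _)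
    let S : Fin n → ℝ := fun i => s i.castSucc - t
    have hS0 (i) : 0 ≤ S i := sub_nonneg.mpr (hs (Fin.le_last _))
    have hS : Antitone S := fun i j hij => sub_le_sub_right (hs (by simpa using hij)) _
    let J : Matrix (Fin (n + 1)) (Fin n) ℂ := (1 : Matrix _ _ ℂ).submatrix id Fin.castSucc
    have hJ : Jᴴ * J = 1 := by
      simp only [J, conjTranspose_submatrix, conjTranspose_one]
      rw [← submatrix_mul _ _ _ _ _ Function.bijective_id, Matrix.one_mul,
        submatrix_one _ (Fin.castSucc_injective n)]
    have hshift : U * diagonal (fun i => (a i : ℂ)) * Uᴴ + diagonal (fun i => (s i : ℂ)) =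
        U * diagonal (fun i => (A i : ℂ)) * Uᴴ + J * diagonal (fun i => (S i : ℂ)) * Jᴴ := by
      have h1 : diagonal (fun i => (A i : ℂ)) = diagonal (fun i => (a i : ℂ)) + (t : ℂ) • 1 := by
        rw [smul_one_eq_diagonal, diagonal_add]
        simp [A]
      have h2 : diagonal (fun i => (s i : ℂ)) =
          (t : ℂ) • 1 + J * diagonal (fun i => (S i : ℂ)) * Jᴴ := by
        ext i j
        simp only [J, Matrix.add_apply, Matrix.mul_apply, Matrix.smul_apply,
          conjTranspose_apply, submatrix_apply, id, one_apply, diagonal_apply]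
        refine Fin.lastCases ?_ (fun i => ?_) i <;> refine Fin.lastCases ?_ (fun j => ?_) j <;>
          simp [S, t, (Fin.castSucc_ne_last _).symm]
        split_ifs <;> simp_all
      rw [h1, h2, Matrix.mul_add, Matrix.add_mul, Matrix.mul_smul, Matrix.smul_mul,
        Matrix.mul_one, hU', add_assoc]
    let B : Matrix (Fin (n + 1)) (Fin (n + 1)) ℂ :=
      U * diagonal (fun i => (((A i)⁻¹ : ℝ) : ℂ)) * Uᴴ
    have hB : B.PosDef := posDef_unitary_conj_diagonal hU' fun i => inv_pos.mpr (hA0 i)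
    have hC : (Jᴴ * B * J).PosDef := hB.conjTranspose_mul_mul_same <|
      Function.LeftInverse.injective (g := fun v => Jᴴ *ᵥ v) fun v => by simp [mulVec_mulVec, hJ]
    obtain ⟨V, b, hV, hV', hb, hVb⟩ := hC.isHermitian.exists_unitary_antitone_diagonal
    have hVC : Vᴴ * (Jᴴ * B * J) * V = diagonal (fun i => (b i : ℂ)) := by
      calc _ = (Vᴴ * V) * diagonal (fun i => (b i : ℂ)) * (Vᴴ * V) := by
            rw [hVb]; simp only [Matrix.mul_assoc]
        _ = _ := by rw [hV, Matrix.one_mul, Matrix.mul_one]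
    have hb0 (i) : 0 < b i := by
      have : (diagonal (fun i => (b i : ℂ))).PosDef := hVC ▸ hC.conjTranspose_mul_mul_same
        (Function.LeftInverse.injective (g := fun v => Vᴴ *ᵥ v) fun v => by
          simp [mulVec_mulVec, hV])
      exact_mod_cast posDef_diagonal_iff.mp this i
    have hbA (i : Fin n) : b i ≤ (A i.castSucc)⁻¹ := by
      refine compression_eigenvalue_le (b := fun i => (A i)⁻¹) (Uᴴ * J * V) ?_
        (fun i j hij => inv_anti₀ (hA0 i) (add_le_add_left (ha hij) t)) hb ?_ i
      · calc _ = Vᴴ * (Jᴴ * (U * Uᴴ) * J) * V := by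
              simp only [conjTranspose_mul, conjTranspose_conjTranspose, Matrix.mul_assoc]
          _ = 1 := by rw [hU', Matrix.mul_one, hJ, Matrix.mul_one, hV]
      · rw [← hVC]
        simp only [B, conjTranspose_mul, conjTranspose_conjTranspose, Matrix.mul_assoc]
    have hswap : (1 + B * (J * diagonal (fun i => (S i : ℂ)) * Jᴴ)).det =
        (1 + V * diagonal (fun i => (b i : ℂ)) * Vᴴ * diagonal (fun i => (S i : ℂ))).det := by
      rw [← hVb, ← Matrix.mul_assoc, det_one_add_mul_comm]
      simp only [Matrix.mul_assoc]
    have hind := det_unitary_conj_diagonal_add_diagonal_le n V hV hV' (fun i => (b i)⁻¹) S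
      (fun i => inv_pos.mpr (hb0 i)) hS0 (fun i j hij => inv_anti₀ (hb0 j) (hb hij)) hS
    rw [det_unitary_conj_diagonal_add hV hV' (fun i => inv_pos.mpr (hb0 i))] at hind
    simp only [inv_inv] at hind
    have hbprod : (0 : ℝ) < ∏ i, b i := prod_pos fun i _ => hb0 i
    have hind' : (1 + V * diagonal (fun i => (b i : ℂ)) * Vᴴ *
        diagonal (fun i => (S i : ℂ))).det ≤ ((∏ i, (1 + b i * S i) : ℝ) : ℂ) := by
      have h := mul_le_mul_of_nonneg_left hind
        (show (0 : ℂ) ≤ ((∏ i, b i : ℝ) : ℂ) by exact_mod_cast hbprod.le)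
      rw [← mul_assoc, ← Complex.ofReal_mul, ← Complex.ofReal_mul, ← prod_mul_distrib,
        ← prod_mul_distrib] at h
      simpa [mul_add, mul_inv_cancel₀ (hb0 _).ne'] using h
    rw [hshift, det_unitary_conj_diagonal_add hU hU' hA0, hswap]
    have hAprod : (0 : ℝ) < ∏ i, A i := prod_pos fun i _ => hA0 i
    refine (mul_le_mul_of_nonneg_left hind' (by exact_mod_cast hAprod.le)).trans ?_
    rw [← Complex.ofReal_mul, Complex.real_le_real, Fin.prod_univ_castSucc,
      Fin.prod_univ_castSucc (fun i => a i + s i), mul_right_comm, ← prod_mul_distrib]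
    refine mul_le_mul_of_nonneg_right (prod_le_prod (fun i _ => ?_) fun i _ => ?_) (hA0 _).le
    · exact mul_nonneg (hA0 _).le (add_nonneg zero_le_one (mul_nonneg (hb0 i).le (hS0 i)))
    · calc A i.castSucc * (1 + b i * S i)
          ≤ A i.castSucc * (1 + (A i.castSucc)⁻¹ * S i) := by
            have := hA0 i.castSucc
            have := hS0 i
            gcongr
            exact hbA i
        _ = A i.castSucc + S i := by
            rw [mul_add, mul_one, mul_inv_cancel_left₀ (hA0 _).ne']
        _ = a i.castSucc + s i.castSucc := by simp [A, S]

/-- **Central intermediate inequality in Appendix E of the paper.** For an `N × N` complex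
unitary matrix `U`, a positive nonincreasing vector `c` and a nonnegative nonincreasing
vector `s`, the determinant `det (U * diag c⁻¹ * Uᴴ + diag s)` is a positive real number and
is at most `∏ i (cᵢ⁻¹ + sᵢ)`. -/
theorem det_diag_inv_add_diag_le (N : ℕ) (hN : 1 ≤ N)
    (U : Matrix (Fin N) (Fin N) ℂ) (hU : Uᴴ * U = 1) (hU' : U * Uᴴ = 1)
    (c s : Fin N → ℝ) (hc0 : ∀ i, 0 < c i) (hs0 : ∀ i, 0 ≤ s i)
    (hc : Antitone c) (hs : Antitone s) :
    (Matrix.det (U * Matrix.diagonal (fun i => ((c i)⁻¹ : ℂ)) * Uᴴ +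
        Matrix.diagonal (fun i => (s i : ℂ)))).im = 0 ∧
    0 < (Matrix.det (U * Matrix.diagonal (fun i => ((c i)⁻¹ : ℂ)) * Uᴴ +
        Matrix.diagonal (fun i => (s i : ℂ)))).re ∧
    (Matrix.det (U * Matrix.diagonal (fun i => ((c i)⁻¹ : ℂ)) * Uᴴ +
        Matrix.diagonal (fun i => (s i : ℂ)))).re ≤ ∏ i, ((c i)⁻¹ + s i) := by
  open scoped ComplexOrder in
  have hinv (i) : 0 < (c i)⁻¹ := inv_pos.mpr (hc0 i)
  have hle := det_unitary_conj_diagonal_add_diagonal_le N U hU hU' (fun i => (c i)⁻¹) s hinv hs0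
    (fun i j hij => inv_anti₀ (hc0 j) (hc hij)) hs
  have hpos := ((posDef_unitary_conj_diagonal hU' hinv).add_posSemidef
    (PosSemidef.diagonal (d := fun i => (s i : ℂ)) fun i => by
      simpa using hs0 i)).det_pos
  simp only [Complex.ofReal_inv] at hle hpos
  rw [Complex.lt_def] at hpos
  rw [Complex.le_def] at hle
  exact ⟨hpos.2.symm, hpos.1, hle.1⟩
end

section
/- Let N_u, N_b, L, P be positive integers. Let A_u ∈ ℂ^{N_u×L}, X ∈ ℂ^{L×P}, A_b ∈ ℂ^{N_b×P}, let T = diag(t) with t ∈ ℂ^L, let G = diag(g) with g ∈ ℂ^P, and let Q ∈ ℂ^{N_b×N_b} be Hermitian positive semidefinite. Define H = A_u T X G A_bᴴ ∈ ℂ^{N_u×N_b}. Then for every integer k with 1 ≤ k ≤ min(N_u, L, P), ∑_{i=1}^k λ_i(H Q Hᴴ) ≤ ∑_{i=1}^k λ_i(A_uᴴ A_u) · λ_i(A_bᴴ Q A_b) · λ_i(Xᴴ X) · λ_i(Gᴴ G) · λ_i(Tᴴ T). -/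
open Matrix Finset

open scoped ComplexOrder

/-- The eigenvalues of a Hermitian matrix arranged in nonincreasing order:
`eigDesc hA 0 ≥ eigDesc hA 1 ≥ …`. -/
noncomputable def eigDesc {n : ℕ} {A : Matrix (Fin n) (Fin n) ℂ} (hA : A.IsHermitian) :
    Fin n → ℝ :=
  fun i => hA.eigenvalues (Tuple.sort hA.eigenvalues i.rev)

namespace EigenvalueChain

/-- Extension of a finite family by zero to a sequence. -/
noncomputable def pad {n : ℕ} (f : Fin n → ℝ) (i : ℕ) : ℝ :=
  if h : i < n then f ⟨i, h⟩ else 0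

lemma pad_val {n : ℕ} (f : Fin n → ℝ) (i : Fin n) : pad f i = f i := by
  simp [pad]

lemma pad_nonneg {n : ℕ} {f : Fin n → ℝ} (hf : ∀ i, 0 ≤ f i) (i : ℕ) : 0 ≤ pad f i := by
  unfold pad
  split_ifs
  exacts [hf _, le_rfl]

lemma pad_antitone {n : ℕ} {f : Fin n → ℝ} (hf : ∀ i, 0 ≤ f i) (hanti : Antitone f) :
    Antitone (pad f) := by
  intro i j hij
  unfold pad
  split_ifs with hj hi hi
  · exact hanti (Fin.mk_le_mk.mpr hij)
  · omega
  · exact hf _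
  · exact le_rfl

lemma sum_range_pad {n : ℕ} (f : Fin n → ℝ) (k : ℕ) :
    ∑ i ∈ range k, pad f i = ∑ i : Fin n, if (i : ℕ) < k then f i else 0 := by
  have h1 : ∑ i : Fin n, (if (i : ℕ) < k then f i else 0)
      = ∑ i ∈ range n, if i < k then pad f i else 0 := by
    rw [Finset.sum_range]
    simp [pad_val]
  rw [h1, ← Finset.sum_filter]
  symm
  apply Finset.sum_subset
  · intro i
    simp
  · intro i hi hi'
    have : ¬ i < n := by
      simp only [mem_filter, mem_range, not_and] at hi hi'
      exact fun h => hi' h hi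
    simp [pad, this]

/-- Abel summation: domination of partial sums is preserved by nonnegative antitone weights. -/
lemma sum_mul_le_sum_mul_of_antitone {w b c : ℕ → ℝ} (hw : ∀ i, 0 ≤ w i) (hanti : Antitone w)
    (k : ℕ) (h : ∀ l ≤ k, ∑ i ∈ range l, c i ≤ ∑ i ∈ range l, b i) :
    ∑ i ∈ range k, w i * c i ≤ ∑ i ∈ range k, w i * b i := by
  have key : ∀ l ≤ k, w l * (∑ i ∈ range l, b i - ∑ i ∈ range l, c i)
      ≤ ∑ i ∈ range l, w i * b i - ∑ i ∈ range l, w i * c i := by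
    intro l
    induction l with
    | zero => simp
    | succ l ih =>
      intro hl
      have h1 := ih (by omega)
      have h2 := h (l + 1) hl
      have h3 := mul_le_mul_of_nonneg_right (hanti (Nat.le_succ l)) (sub_nonneg.mpr h2)
      simp only [Finset.sum_range_succ, Nat.succ_eq_add_one] at h3 ⊢
      nlinarith
  have h1 := key k le_rfl
  have h2 := mul_nonneg (hw k) (sub_nonneg.mpr (h k le_rfl))
  linarith

/-- A fractional selection of total weight at most `k` from a nonincreasing nonnegative family
is worth at most the `k` largest entries. -/
lemma sum_mul_le_sum_range_pad {n : ℕ} {d q : Fin n → ℝ} (hd : ∀ i, 0 ≤ d i) (hanti : Antitone d)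
    (hq : ∀ i, 0 ≤ q i) (hq1 : ∀ i, q i ≤ 1) {k : ℕ} (hqk : ∑ i, q i ≤ k) :
    ∑ i, d i * q i ≤ ∑ i ∈ range k, pad d i := by
  rw [sum_range_pad]
  rcases lt_or_ge k n with hk | hk
  · have h1 : ∀ i : Fin n, d i * q i - (if (i : ℕ) < k then d i else 0)
        ≤ d ⟨k, hk⟩ * (q i - if (i : ℕ) < k then 1 else 0) := by
      intro i
      split_ifs with hi
      · have : d ⟨k, hk⟩ ≤ d i := hanti (Fin.le_def.mpr hi.le)
        nlinarith [hq1 i]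
      · have : d i ≤ d ⟨k, hk⟩ := hanti (Fin.le_def.mpr (not_lt.mp hi))
        nlinarith [hq i]
    have h2 := Finset.sum_le_sum fun i (_ : i ∈ univ) => h1 i
    have h3 : ∑ i : Fin n, (if (i : ℕ) < k then (1 : ℝ) else 0) = k := by
      rw [← sum_range_pad (fun _ => (1 : ℝ))]
      trans ∑ i ∈ range k, (1 : ℝ)
      · refine Finset.sum_congr rfl fun i hi => ?_
        have : i < n := (mem_range.mp hi).trans hk
        simp [pad, this]
      · simp
    rw [← Finset.mul_sum, Finset.sum_sub_distrib, Finset.sum_sub_distrib, h3] at h2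
    nlinarith [hd ⟨k, hk⟩]
  · refine Finset.sum_le_sum fun i _ => ?_
    rw [if_pos (i.2.trans_le hk)]
    nlinarith [hd i, hq1 i]

lemma eigDesc_antitone {n : ℕ} {A : Matrix (Fin n) (Fin n) ℂ} (hA : A.IsHermitian) :
    Antitone (eigDesc hA) :=
  fun _ _ hij => Tuple.monotone_sort hA.eigenvalues (Fin.rev_le_rev.mpr hij)

lemma eigDesc_nonneg {n : ℕ} {A : Matrix (Fin n) (Fin n) ℂ} (hA : A.PosSemidef) (i : Fin n) :
    0 ≤ eigDesc hA.isHermitian i :=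
  hA.eigenvalues_nonneg _

lemma exists_eq_mul_diagonal_eigDesc {n : ℕ} {A : Matrix (Fin n) (Fin n) ℂ}
    (hA : A.IsHermitian) : ∃ U : Matrix (Fin n) (Fin n) ℂ, Uᴴ * U = 1 ∧ U * Uᴴ = 1 ∧
      A = U * diagonal (fun i => (eigDesc hA i : ℂ)) * Uᴴ := by
  let e : Fin n ≃ Fin n := Fin.revPerm.trans (Tuple.sort hA.eigenvalues)
  let V : Matrix (Fin n) (Fin n) ℂ := hA.eigenvectorUnitary
  have hV : Vᴴ * V = 1 := Unitary.coe_star_mul_self hA.eigenvectorUnitary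
  have hV' : V * Vᴴ = 1 := Unitary.coe_mul_star_self hA.eigenvectorUnitary
  refine ⟨V.submatrix id e, ?_, ?_, ?_⟩
  · rw [conjTranspose_submatrix, ← submatrix_mul _ _ _ _ _ Function.bijective_id, hV]
    simp
  · rw [conjTranspose_submatrix, ← submatrix_mul _ _ _ _ _ e.bijective, hV']
    simp
  · have h : diagonal (fun i => (eigDesc hA i : ℂ))
        = (diagonal (fun i => (hA.eigenvalues i : ℂ))).submatrix e e := by
      rw [submatrix_diagonal_equiv]
      rfl
    rw [h, conjTranspose_submatrix, ← submatrix_mul _ _ _ _ _ e.bijective,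
      ← submatrix_mul _ _ _ _ _ e.bijective, submatrix_id_id]
    exact hA.spectral_theorem

lemma posSemidef_of_projection {n : ℕ} {E : Matrix (Fin n) (Fin n) ℂ} (hE : E.IsHermitian)
    (hE2 : E * E = E) : E.PosSemidef := by
  have := posSemidef_conjTranspose_mul_self E
  rwa [hE.eq, hE2] at this

lemma one_sub_projection {n : ℕ} {E : Matrix (Fin n) (Fin n) ℂ} (hE : E.IsHermitian)
    (hE2 : E * E = E) : (1 - E).IsHermitian ∧ (1 - E) * (1 - E) = 1 - E := by
  refine ⟨isHermitian_one.sub hE, ?_⟩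
  simp [sub_mul, mul_sub, hE2]

lemma trace_mul_re_nonneg {n : ℕ} {E M : Matrix (Fin n) (Fin n) ℂ} (hE : E.IsHermitian)
    (hE2 : E * E = E) (hM : M.PosSemidef) : 0 ≤ (E * M).trace.re := by
  have h := (hM.mul_mul_conjTranspose_same E).trace_nonneg
  rw [trace_mul_comm, hE.eq, ← Matrix.mul_assoc, hE2] at h
  exact (Complex.le_def.mp h).1

lemma trace_mul_re_le {n : ℕ} {E M : Matrix (Fin n) (Fin n) ℂ} (hE : E.IsHermitian)
    (hE2 : E * E = E) (hM : M.PosSemidef) : (E * M).trace.re ≤ M.trace.re := by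
  obtain ⟨h1, h2⟩ := one_sub_projection hE hE2
  have h := trace_mul_re_nonneg h1 h2 hM
  rw [Matrix.sub_mul, Matrix.one_mul, trace_sub, Complex.sub_re] at h
  linarith

lemma posSemidef_diag_re_nonneg {n : ℕ} {M : Matrix (Fin n) (Fin n) ℂ} (hM : M.PosSemidef)
    (i : Fin n) : 0 ≤ (M i i).re :=
  (Complex.le_def.mp hM.diag_nonneg).1

lemma trace_diagonal_mul_re {n : ℕ} (d : Fin n → ℝ) (M : Matrix (Fin n) (Fin n) ℂ) :
    (diagonal (fun i => (d i : ℂ)) * M).trace.re = ∑ i, d i * (M i i).re := by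
  simp [Matrix.trace, diagonal_mul]

/-- Ky Fan's upper bound. -/
lemma trace_projection_mul_le {n : ℕ} {M E : Matrix (Fin n) (Fin n) ℂ} (hM : M.PosSemidef)
    (hE : E.IsHermitian) (hE2 : E * E = E) {k : ℕ} (hk : E.trace.re ≤ k) :
    (E * M).trace.re ≤ ∑ i ∈ range k, pad (eigDesc hM.isHermitian) i := by
  obtain ⟨U, hU, hU', hMU⟩ := exists_eq_mul_diagonal_eigDesc hM.isHermitian
  set d := eigDesc hM.isHermitian
  have htr : (E * M).trace = (diagonal (fun i => (d i : ℂ)) * (Uᴴ * E * U)).trace := by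
    rw [hMU, ← Matrix.mul_assoc, trace_mul_comm, ← Matrix.mul_assoc, ← Matrix.mul_assoc,
      trace_mul_comm]
  obtain ⟨h1, h2⟩ := one_sub_projection hE hE2
  rw [htr, trace_diagonal_mul_re]
  refine sum_mul_le_sum_range_pad (eigDesc_nonneg hM) (eigDesc_antitone _)
    (posSemidef_diag_re_nonneg
      ((posSemidef_of_projection hE hE2).conjTranspose_mul_mul_same U)) (fun i => ?_) ?_
  · have := posSemidef_diag_re_nonneg
      ((posSemidef_of_projection h1 h2).conjTranspose_mul_mul_same U) i
    rw [Matrix.mul_sub, Matrix.sub_mul, Matrix.mul_one, hU] at this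
    simpa using this
  · have : (Uᴴ * E * U).trace = E.trace := by
      rw [trace_mul_comm, ← Matrix.mul_assoc, hU', Matrix.one_mul]
    rw [← this] at hk
    simpa [Matrix.trace] using hk

/-- Ky Fan's upper bound for `A Aᴴ`, in terms of the eigenvalues of `Aᴴ A`. -/
lemma trace_conjTranspose_projection_mul_le {m n : ℕ} (A : Matrix (Fin m) (Fin n) ℂ)
    {E : Matrix (Fin m) (Fin m) ℂ} (hE : E.IsHermitian) (hE2 : E * E = E) {k : ℕ}
    (hk : E.trace.re ≤ k) :
    (Aᴴ * E * A).trace.re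
      ≤ ∑ i ∈ range k, pad (eigDesc (posSemidef_conjTranspose_mul_self A).isHermitian) i := by
  have hM := posSemidef_conjTranspose_mul_self A
  obtain ⟨U, hU, hU', hMU⟩ := exists_eq_mul_diagonal_eigDesc hM.isHermitian
  have hd0 := eigDesc_nonneg hM
  have hanti := eigDesc_antitone hM.isHermitian
  set d := eigDesc hM.isHermitian
  let R : Matrix (Fin m) (Fin n) ℂ := A * U
  have hR : Rᴴ * R = diagonal (fun i => (d i : ℂ)) := by
    calc Rᴴ * R = Uᴴ * (Aᴴ * A) * U := by simp [R, Matrix.mul_assoc]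
      _ = (Uᴴ * U) * diagonal (fun i => (d i : ℂ)) * (Uᴴ * U) := by
        rw [hMU]
        simp only [Matrix.mul_assoc]
      _ = _ := by rw [hU, Matrix.one_mul, Matrix.mul_one]
  obtain ⟨h1, h2⟩ := one_sub_projection hE hE2
  let r : Fin n → ℝ := fun i => ((Rᴴ * E * R) i i).re
  have hr0 : ∀ i, 0 ≤ r i := posSemidef_diag_re_nonneg
    ((posSemidef_of_projection hE hE2).conjTranspose_mul_mul_same R)
  have hrd : ∀ i, r i ≤ d i := by
    intro i
    have := posSemidef_diag_re_nonneg
      ((posSemidef_of_projection h1 h2).conjTranspose_mul_mul_same R) i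
    rw [Matrix.mul_sub, Matrix.sub_mul, Matrix.mul_one, hR] at this
    simpa [r] using this
  have hdr : ∀ i, d i * ((d i)⁻¹ * r i) = r i := by
    intro i
    rcases eq_or_ne (d i) 0 with h | h
    · have := hr0 i
      have := hrd i
      rw [h]
      linarith
    · field_simp
  have htr : (Aᴴ * E * A).trace.re = ∑ i, d i * ((d i)⁻¹ * r i) := by
    have : (Rᴴ * E * R).trace = (Aᴴ * E * A).trace := by
      calc (Rᴴ * E * R).trace = (Uᴴ * (Aᴴ * E * A * U)).trace := by
            simp [R, Matrix.mul_assoc]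
        _ = (Aᴴ * E * A * (U * Uᴴ)).trace := by
            rw [trace_mul_comm, Matrix.mul_assoc (Aᴴ * E * A)]
        _ = _ := by rw [hU', Matrix.mul_one]
    rw [← this]
    simp [hdr, r, Matrix.trace]
  rw [htr]
  refine sum_mul_le_sum_range_pad hd0 hanti (fun i => mul_nonneg (inv_nonneg.mpr (hd0 i)) (hr0 i))
    (fun i => ?_) ?_
  · rcases (hd0 i).eq_or_lt with h | h
    · simp [← h]
    · rw [inv_mul_le_iff₀ h]
      simpa using hrd i
  · let D' : Matrix (Fin n) (Fin n) ℂ := diagonal (fun i => (((d i)⁻¹ : ℝ) : ℂ))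
    let F : Matrix (Fin m) (Fin m) ℂ := R * D' * Rᴴ
    have hD' : D'ᴴ = D' := by
      ext i j
      simp only [D', diagonal_conjTranspose]
      congr 2
      ext i
      simp
    have hF : F.IsHermitian := by
      simp [F, Matrix.IsHermitian, hD', Matrix.mul_assoc]
    have hDD : D' * (diagonal (fun i => (d i : ℂ)) * D') = D' := by
      simp only [D', diagonal_mul_diagonal]
      congr 1
      ext i
      rcases eq_or_ne (d i) 0 with h | h
      · simp [h]
      · have : (d i : ℂ) ≠ 0 := by exact_mod_cast h
        push_cast
        field_simp
    have hF2 : F * F = F := by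
      calc F * F = R * (D' * ((Rᴴ * R) * D')) * Rᴴ := by simp only [F, Matrix.mul_assoc]
        _ = F := by rw [hR, hDD]
    have hFE := trace_mul_re_le hF hF2 (posSemidef_of_projection hE hE2)
    have : (F * E).trace = (D' * (Rᴴ * E * R)).trace := by
      calc (F * E).trace = (R * (D' * Rᴴ * E)).trace := by simp only [F, Matrix.mul_assoc]
        _ = _ := by
          rw [trace_mul_comm]
          simp only [Matrix.mul_assoc]
    rw [this, trace_diagonal_mul_re] at hFE
    exact hFE.trans hk

/-- The spectral projection onto the span of the first `k` columns of a unitary matrix. -/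
noncomputable def firstProjection {n : ℕ} (U : Matrix (Fin n) (Fin n) ℂ) (k : ℕ) :
    Matrix (Fin n) (Fin n) ℂ :=
  U * diagonal (fun i : Fin n => ((if (i : ℕ) < k then 1 else 0 : ℝ) : ℂ)) * Uᴴ

lemma firstProjection_isHermitian {n : ℕ} (U : Matrix (Fin n) (Fin n) ℂ) (k : ℕ) :
    (firstProjection U k).IsHermitian := by
  refine isHermitian_mul_mul_conjTranspose U ?_
  rw [isHermitian_diagonal_iff]
  intro i
  simp [isSelfAdjoint_iff]

lemma firstProjection_mul_self {n : ℕ} {U : Matrix (Fin n) (Fin n) ℂ} (hU : Uᴴ * U = 1) (k : ℕ) :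
    firstProjection U k * firstProjection U k = firstProjection U k := by
  unfold firstProjection
  set D : Matrix (Fin n) (Fin n) ℂ :=
    diagonal (fun i : Fin n => ((if (i : ℕ) < k then 1 else 0 : ℝ) : ℂ)) with hD
  have hDD : D * D = D := by
    rw [hD, diagonal_mul_diagonal]
    congr 1
    ext i
    split_ifs <;> simp
  calc U * D * Uᴴ * (U * D * Uᴴ) = U * (D * (Uᴴ * U) * D) * Uᴴ := by
        simp only [Matrix.mul_assoc]
    _ = _ := by rw [hU, Matrix.mul_one, hDD]

lemma trace_firstProjection_mul {n : ℕ} (U M : Matrix (Fin n) (Fin n) ℂ) (k : ℕ) :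
    (firstProjection U k * M).trace.re
      = ∑ i ∈ range k, pad (fun i => ((Uᴴ * M * U) i i).re) i := by
  have : (firstProjection U k * M).trace
      = (diagonal (fun i : Fin n => ((if (i : ℕ) < k then 1 else 0 : ℝ) : ℂ)) * (Uᴴ * M * U)).trace := by
    unfold firstProjection
    rw [Matrix.mul_assoc, Matrix.mul_assoc, trace_mul_comm]
    simp only [Matrix.mul_assoc]
  rw [this, trace_diagonal_mul_re, sum_range_pad]
  simp

lemma trace_firstProjection_le {n : ℕ} {U : Matrix (Fin n) (Fin n) ℂ} (hU : Uᴴ * U = 1) (k : ℕ) :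
    (firstProjection U k).trace.re ≤ k := by
  have := trace_firstProjection_mul U 1 k
  rw [Matrix.mul_one, Matrix.mul_one, hU] at this
  rw [this]
  calc _ ≤ ∑ i ∈ range k, (1 : ℝ) := by
        refine Finset.sum_le_sum fun i _ => ?_
        unfold pad
        split_ifs <;> simp
    _ = k := by simp

/-- Weak majorization of the eigenvalues of `A S Aᴴ` by the products of those of `Aᴴ A` and `S`. -/
lemma sum_pad_eigDesc_mul_mul_conjTranspose_le {m n : ℕ} (A : Matrix (Fin m) (Fin n) ℂ)
    {S : Matrix (Fin n) (Fin n) ℂ} (hS : S.PosSemidef) (k : ℕ) :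
    ∑ i ∈ range k, pad (eigDesc (hS.mul_mul_conjTranspose_same A).isHermitian) i
      ≤ ∑ i ∈ range k, pad (eigDesc (posSemidef_conjTranspose_mul_self A).isHermitian) i *
          pad (eigDesc hS.isHermitian) i := by
  have hAA := posSemidef_conjTranspose_mul_self A
  obtain ⟨V, hV, hV', hMV⟩ :=
    exists_eq_mul_diagonal_eigDesc (hS.mul_mul_conjTranspose_same A).isHermitian
  obtain ⟨U, hU, hU', hSU⟩ := exists_eq_mul_diagonal_eigDesc hS.isHermitian
  have hs0 := eigDesc_nonneg hS
  have hs := eigDesc_antitone hS.isHermitian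
  have ha0 := eigDesc_nonneg hAA
  set s := eigDesc hS.isHermitian
  set a := eigDesc hAA.isHermitian
  set d := eigDesc (hS.mul_mul_conjTranspose_same A).isHermitian
  have hE := firstProjection_isHermitian V k
  have hE2 := firstProjection_mul_self hV k
  have hEk := trace_firstProjection_le hV k
  have hd : (firstProjection V k * (A * S * Aᴴ)).trace.re = ∑ i ∈ range k, pad d i := by
    have : Vᴴ * (A * S * Aᴴ) * V = diagonal (fun i => (d i : ℂ)) := by
      calc _ = (Vᴴ * V) * diagonal (fun i => (d i : ℂ)) * (Vᴴ * V) := by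
            rw [hMV]
            simp only [Matrix.mul_assoc]
        _ = _ := by rw [hV, Matrix.one_mul, Matrix.mul_one]
    rw [trace_firstProjection_mul, this]
    simp
  set E := firstProjection V k
  let c : Fin n → ℝ := fun i => ((Uᴴ * (Aᴴ * E * A) * U) i i).re
  have hEA := (posSemidef_of_projection hE hE2).conjTranspose_mul_mul_same A
  have hc : ∑ i ∈ range k, pad d i = ∑ i ∈ range n, pad s i * pad c i := by
    have : (E * (A * S * Aᴴ)).trace
        = (diagonal (fun i => (s i : ℂ)) * (Uᴴ * (Aᴴ * E * A) * U)).trace := by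
      calc _ = ((E * A * U) * (diagonal (fun i => (s i : ℂ)) * Uᴴ * Aᴴ)).trace := by
            rw [hSU]
            simp only [Matrix.mul_assoc]
        _ = _ := by
            rw [trace_mul_comm]
            simp only [Matrix.mul_assoc]
    rw [← hd, this, trace_diagonal_mul_re, Finset.sum_range]
    simp [pad_val, c]
  have hpart : ∀ l, ∑ i ∈ range l, pad c i ≤ ∑ i ∈ range l, if i < k then pad a i else 0 := by
    intro l
    have hP := firstProjection_isHermitian U l
    have hP2 := firstProjection_mul_self hU l
    have hPl := trace_firstProjection_le hU l
    rw [show ∑ i ∈ range l, pad c i = (firstProjection U l * (Aᴴ * E * A)).trace.re from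
      (trace_firstProjection_mul U _ l).symm]
    rcases le_total l k with hlk | hkl
    · have h1 : ∑ i ∈ range l, (if i < k then pad a i else 0) = ∑ i ∈ range l, pad a i :=
        Finset.sum_congr rfl fun i hi => if_pos ((mem_range.mp hi).trans_le hlk)
      rw [h1]
      refine le_trans ?_ (trace_projection_mul_le hAA hP hP2 hPl)
      obtain ⟨h2, h3⟩ := one_sub_projection hE hE2
      have h4 := trace_mul_re_nonneg hP hP2
        ((posSemidef_of_projection h2 h3).conjTranspose_mul_mul_same A)
      rw [Matrix.mul_sub, Matrix.sub_mul, Matrix.mul_one, Matrix.mul_sub, trace_sub,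
        Complex.sub_re] at h4
      linarith
    · have h1 : ∑ i ∈ range l, (if i < k then pad a i else 0) = ∑ i ∈ range k, pad a i := by
        rw [← Finset.sum_filter]
        congr 1
        ext i
        simp only [mem_filter, mem_range]
        omega
      rw [h1]
      exact (trace_mul_re_le hP hP2 hEA).trans (trace_conjTranspose_projection_mul_le A hE hE2 hEk)
  rw [hc]
  refine (sum_mul_le_sum_mul_of_antitone (pad_nonneg hs0) (pad_antitone hs0 hs) n
    fun l _ => hpart l).trans ?_
  simp only [mul_ite, mul_zero]
  rw [← Finset.sum_filter]
  simp only [mul_comm (pad a _)]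
  refine Finset.sum_le_sum_of_subset_of_nonneg (fun i => by simp) fun i _ _ =>
    mul_nonneg (pad_nonneg hs0 i) (pad_nonneg ha0 i)

/-- Weighted form of `sum_pad_eigDesc_mul_mul_conjTranspose_le`. -/
lemma sum_mul_pad_eigDesc_le {m n : ℕ} (A : Matrix (Fin m) (Fin n) ℂ)
    {S : Matrix (Fin n) (Fin n) ℂ} (hS : S.PosSemidef) {w : ℕ → ℝ} (hw : ∀ i, 0 ≤ w i)
    (hanti : Antitone w) (k : ℕ) :
    ∑ i ∈ range k, w i * pad (eigDesc (hS.mul_mul_conjTranspose_same A).isHermitian) i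
      ≤ ∑ i ∈ range k, w i * pad (eigDesc (posSemidef_conjTranspose_mul_self A).isHermitian) i *
          pad (eigDesc hS.isHermitian) i := by
  simp only [mul_assoc]
  exact sum_mul_le_sum_mul_of_antitone hw hanti k
    fun l _ => sum_pad_eigDesc_mul_mul_conjTranspose_le A hS l

lemma pad_eigDesc_gram_nonneg {m n : ℕ} (A : Matrix (Fin m) (Fin n) ℂ) (i : ℕ) :
    0 ≤ pad (eigDesc (posSemidef_conjTranspose_mul_self A).isHermitian) i :=
  pad_nonneg (eigDesc_nonneg (posSemidef_conjTranspose_mul_self A)) i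

lemma pad_eigDesc_gram_antitone {m n : ℕ} (A : Matrix (Fin m) (Fin n) ℂ) :
    Antitone (pad (eigDesc (posSemidef_conjTranspose_mul_self A).isHermitian)) :=
  pad_antitone (eigDesc_nonneg (posSemidef_conjTranspose_mul_self A)) (eigDesc_antitone _)

lemma antitone_mul_of_nonneg {u v : ℕ → ℝ} (hu : Antitone u) (hv : Antitone v)
    (hu0 : ∀ i, 0 ≤ u i) (hv0 : ∀ i, 0 ≤ v i) : Antitone fun i => u i * v i :=
  fun i j hij => mul_le_mul (hu hij) (hv hij) (hv0 j) (hu0 i)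

lemma pad_castLE {n k : ℕ} (f : Fin n → ℝ) (h : k ≤ n) (i : Fin k) :
    f (Fin.castLE h i) = pad f i :=
  (pad_val f (Fin.castLE h i)).symm

lemma pad_eigDesc_congr {n : ℕ} {A B : Matrix (Fin n) (Fin n) ℂ} (h : A = B)
    (hA : A.IsHermitian) (hB : B.IsHermitian) : pad (eigDesc hA) = pad (eigDesc hB) := by
  subst h
  rfl

end EigenvalueChain

/-- **Weak-majorization (additive) eigenvalue chain of Theorem 1 of the paper (Appendix A).**
With `H = A_u T X G A_bᴴ`, `T = diag t`, `G = diag g` and `Q ⪰ 0`, for every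
`1 ≤ k ≤ min(N_u, L, P)`,
`∑_{i=1}^k λᵢ(H Q Hᴴ) ≤ ∑_{i=1}^k λᵢ(A_uᴴA_u) λᵢ(A_bᴴQA_b) λᵢ(XᴴX) λᵢ(GᴴG) λᵢ(TᴴT)`. -/
theorem sum_eigenvalues_channel_le (Nu Nb L P : ℕ)
    (hNu : 0 < Nu) (hNb : 0 < Nb) (hL : 0 < L) (hP : 0 < P)
    (Au : Matrix (Fin Nu) (Fin L) ℂ) (X : Matrix (Fin L) (Fin P) ℂ)
    (Ab : Matrix (Fin Nb) (Fin P) ℂ) (t : Fin L → ℂ) (g : Fin P → ℂ)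
    (Q : Matrix (Fin Nb) (Fin Nb) ℂ) (hQ : Q.PosSemidef)
    (k : ℕ) (hk1 : 1 ≤ k) (hk : k ≤ min Nu (min L P)) :
    ∑ i : Fin k,
        eigDesc (hQ.mul_mul_conjTranspose_same
            (Au * Matrix.diagonal t * X * Matrix.diagonal g * Abᴴ)).isHermitian
          (Fin.castLE (hk.trans (min_le_left _ _)) i)
      ≤ ∑ i : Fin k,
          eigDesc (Matrix.posSemidef_conjTranspose_mul_self Au).isHermitian
              (Fin.castLE (hk.trans ((min_le_right _ _).trans (min_le_left _ _))) i) *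
          eigDesc (hQ.conjTranspose_mul_mul_same Ab).isHermitian
              (Fin.castLE (hk.trans ((min_le_right _ _).trans (min_le_right _ _))) i) *
          eigDesc (Matrix.posSemidef_conjTranspose_mul_self X).isHermitian
              (Fin.castLE (hk.trans ((min_le_right _ _).trans (min_le_right _ _))) i) *
          eigDesc (Matrix.posSemidef_conjTranspose_mul_self (Matrix.diagonal g)).isHermitian
              (Fin.castLE (hk.trans ((min_le_right _ _).trans (min_le_right _ _))) i) *
          eigDesc (Matrix.posSemidef_conjTranspose_mul_self (Matrix.diagonal t)).isHermitian
              (Fin.castLE (hk.trans ((min_le_right _ _).trans (min_le_left _ _))) i) := by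
  simp only [EigenvalueChain.pad_castLE]
  have hS := hQ.conjTranspose_mul_mul_same Ab
  have hS₁ := hS.mul_mul_conjTranspose_same (diagonal g)
  have hS₂ := hS₁.mul_mul_conjTranspose_same X
  have hS₃ := hS₂.mul_mul_conjTranspose_same (diagonal t)
  have hS₄ := hS₃.mul_mul_conjTranspose_same Au
  rw [EigenvalueChain.pad_eigDesc_congr (by simp [Matrix.mul_assoc]) _ hS₄.isHermitian]
  have hu := EigenvalueChain.pad_eigDesc_gram_antitone Au
  have hu0 := EigenvalueChain.pad_eigDesc_gram_nonneg Au
  have ht := EigenvalueChain.pad_eigDesc_gram_antitone (diagonal t)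
  have ht0 := EigenvalueChain.pad_eigDesc_gram_nonneg (diagonal t)
  have hx := EigenvalueChain.pad_eigDesc_gram_antitone X
  have hx0 := EigenvalueChain.pad_eigDesc_gram_nonneg X
  have hut0 := fun i => mul_nonneg (hu0 i) (ht0 i)
  have hut := EigenvalueChain.antitone_mul_of_nonneg hu ht hu0 ht0
  have hutx0 := fun i => mul_nonneg (hut0 i) (hx0 i)
  have hutx := EigenvalueChain.antitone_mul_of_nonneg hut hx hut0 hx0
  have h1 := EigenvalueChain.sum_pad_eigDesc_mul_mul_conjTranspose_le Au hS₃ k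
  have h2 := EigenvalueChain.sum_mul_pad_eigDesc_le (diagonal t) hS₂ hu0 hu k
  have h3 := EigenvalueChain.sum_mul_pad_eigDesc_le X hS₁ hut0 hut k
  have h4 := EigenvalueChain.sum_mul_pad_eigDesc_le (diagonal g) hS hutx0 hutx k
  have h := ((h1.trans h2).trans h3).trans h4
  rw [Finset.sum_range, Finset.sum_range] at h
  refine h.trans_eq (Finset.sum_congr rfl fun i _ => ?_)
  ring
end
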